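/- arXiv:1605.09255 — 2 statements merged into one kernel-verified Lean document; each statement's English description precedes it below -/
import Mathlib

section
/- Let P be a 2-term silting complex in K^b(proj A). Then T(P) = Fac H^0(P); that is, a finitely generated A-module X satisfies Hom_D(P, X[1]) = 0 if and only if X is a quotient of a finite direct sum of copies of H^0(P). -/
/-!
Common setup: we model right `A`-modules as `ModuleCat Aᵐᵒᵖ`, the bounded derived
category `D^b(mod A)` as the full subcategory (given by the predicate `InDb`) of the
derived category of `Mod Aᵐᵒᵖ` consisting of cohomologically bounded complexes with
finitely generated cohomology, and `K^b(proj A)` via bounded complexes of finitely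
generated projective modules (`IsPerfCplx`).
-/

namespace TwoTermSilting

open CategoryTheory Limits Pretriangulated

universe w v u

noncomputable section

/-- The projective dimension of the module `M` is at most `n`. -/
def pdLE (R : Type u) [Ring R] : ℕ → ModuleCat.{v} R → Prop
  | 0, M => Projective M
  | (n+1), M => ∃ (P : ModuleCat.{v} R) (f : P ⟶ M),
      Projective P ∧ Epi f ∧ pdLE R n (kernel f)

/-- The (right) global dimension of `R` is at most `d`: every finitely generated
module has projective dimension at most `d`. -/
def gldLE (R : Type u) [Ring R] (d : ℕ) : Prop :=
  ∀ M : ModuleCat.{v} R, Module.Finite R M → pdLE R d M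

section Star

variable {C : Type u} [Category.{v} C] [HasZeroObject C] [Preadditive C] [HasShift C ℤ]
  [∀ n : ℤ, (shiftFunctor C n).Additive] [Pretriangulated C]

/-- `star S T` consists of the objects `Z` sitting in a distinguished triangle
`X ⟶ Z ⟶ Y ⟶ X⟦1⟧` with `X ∈ S` and `Y ∈ T`. -/
def star (S T : Set C) : Set C :=
  {Z | ∃ (X Y : C) (f : X ⟶ Z) (g : Z ⟶ Y) (h : Y ⟶ X⟦(1 : ℤ)⟧),
    X ∈ S ∧ Y ∈ T ∧ Triangle.mk f g h ∈ distTriang C}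

/-- `starChain f n` is the iterated star product `f 0 * f 1 * ⋯ * f n`
(the star operation being associative). -/
def starChain (f : ℕ → Set C) : ℕ → Set C
  | 0 => f 0
  | (n+1) => star (starChain f n) (f (n+1))

/-- The closure of a class of objects under the shift by `n`. -/
def shiftSet (S : Set C) (n : ℤ) : Set C :=
  {Y | ∃ X ∈ S, Nonempty (Y ≅ X⟦n⟧)}

/-- The additive closure of the object `X`: all direct summands of finite direct sums
of copies of `X`. -/
def addOf (X : C) : Set C :=
  {Y | ∃ (n : ℕ) (ι : Y ⟶ ⨁ (fun _ : Fin n => X)) (r : (⨁ (fun _ : Fin n => X)) ⟶ Y),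
    ι ≫ r = 𝟙 Y}

/-- A class of objects of a (pre)triangulated category is thick if it is closed under
isomorphisms, shifts, extensions and direct summands. -/
def IsThick (S : Set C) : Prop :=
  (∀ ⦃X Y : C⦄, (X ≅ Y) → X ∈ S → Y ∈ S) ∧
  (∀ (X : C) (n : ℤ), X ∈ S → (X⟦n⟧) ∈ S) ∧
  (∀ T : Triangle C, (T ∈ distTriang C) → T.obj₁ ∈ S → T.obj₃ ∈ S → T.obj₂ ∈ S) ∧
  (∀ (X Y : C) (ι : X ⟶ Y) (r : Y ⟶ X), ι ≫ r = 𝟙 X → Y ∈ S → X ∈ S)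

end Star

/-- The right `End Y`-module structure on `Y ⟶ X`, by precomposition. -/
instance endModule {C : Type u} [Category.{v} C] [Preadditive C] (Y X : C) :
    Module (End Y)ᵐᵒᵖ (Y ⟶ X) where
  smul b f := b.unop ≫ f
  one_smul f := Category.id_comp f
  mul_smul b₁ b₂ f := by
    show (b₁ * b₂).unop ≫ f = b₁.unop ≫ (b₂.unop ≫ f)
    have h : (b₁ * b₂).unop = b₁.unop ≫ b₂.unop := rfl
    rw [h, Category.assoc]
  smul_zero b := Limits.comp_zero
  smul_add b f g := Preadditive.comp_add _ _ _ _ _ _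
  add_smul b₁ b₂ f := Preadditive.add_comp _ _ _ _ _ _
  zero_smul f := Limits.zero_comp

section Main

variable (R : Type) [Ring R] [HasDerivedCategory.{w} (ModuleCat.{0} R)]

/-- A bounded complex of finitely generated projective modules
(an object of `K^b(proj R)`). -/
def IsPerfCplx (X : CochainComplex (ModuleCat.{0} R) ℤ) : Prop :=
  (∀ i, Projective (X.X i)) ∧ (∀ i, Module.Finite R (X.X i)) ∧
    ∃ a b : ℤ, ∀ i, (i < a ∨ b < i) → IsZero (X.X i)

/-- A complex of finitely generated projective modules concentrated in
degrees `-1` and `0`. -/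
def IsTwoTermCplx (X : CochainComplex (ModuleCat.{0} R) ℤ) : Prop :=
  (∀ i, Projective (X.X i)) ∧ (∀ i, Module.Finite R (X.X i)) ∧
    ∀ i, i ≠ -1 → i ≠ 0 → IsZero (X.X i)

/-- A two-term silting complex: a two-term complex of finitely generated projectives `P`
with `Hom_D(P, P[1]) = 0`, such that the smallest thick subcategory containing `P`
contains all of `K^b(proj R)`. -/
def IsTwoTermSilting (P : CochainComplex (ModuleCat.{0} R) ℤ) : Prop :=
  IsTwoTermCplx R P ∧
  (∀ f : DerivedCategory.Q.obj P ⟶ (DerivedCategory.Q.obj P)⟦(1 : ℤ)⟧, f = 0) ∧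
  (∀ S : Set (DerivedCategory (ModuleCat.{0} R)), IsThick S →
    DerivedCategory.Q.obj P ∈ S →
    ∀ X : CochainComplex (ModuleCat.{0} R) ℤ, IsPerfCplx R X → DerivedCategory.Q.obj X ∈ S)

/-- The objects of the derived category which belong to `D^b(mod R)`: cohomologically
bounded complexes with finitely generated cohomology. -/
def InDb (X : DerivedCategory (ModuleCat.{0} R)) : Prop :=
  (∃ a b : ℤ, ∀ i, (i < a ∨ b < i) →
    IsZero ((DerivedCategory.homologyFunctor (ModuleCat.{0} R) i).obj X)) ∧
  (∀ i : ℤ, Module.Finite R ((DerivedCategory.homologyFunctor (ModuleCat.{0} R) i).obj X))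

variable {R}

/-- The torsion class `T(P)` of finitely generated modules `X` with `Hom_D(P, X[1]) = 0`. -/
def TT (P : CochainComplex (ModuleCat.{0} R) ℤ) : Set (ModuleCat.{0} R) :=
  {X | Module.Finite R X ∧
    ∀ f : DerivedCategory.Q.obj P ⟶
      ((DerivedCategory.singleFunctor (ModuleCat.{0} R) 0).obj X)⟦(1 : ℤ)⟧, f = 0}

/-- The torsion-free class `F(P)` of finitely generated modules `Y` with `Hom_D(P, Y) = 0`. -/
def FF (P : CochainComplex (ModuleCat.{0} R) ℤ) : Set (ModuleCat.{0} R) :=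
  {Y | Module.Finite R Y ∧
    ∀ f : DerivedCategory.Q.obj P ⟶
      (DerivedCategory.singleFunctor (ModuleCat.{0} R) 0).obj Y, f = 0}

/-- The heart `C(P) = {X ∈ D^b(mod R) | Hom_D(P, X[i]) = 0 for all i ≠ 0}`. -/
def CP (P : CochainComplex (ModuleCat.{0} R) ℤ) : Set (DerivedCategory (ModuleCat.{0} R)) :=
  {X | InDb R X ∧ ∀ i : ℤ, i ≠ 0 → ∀ f : DerivedCategory.Q.obj P ⟶ X⟦i⟧, f = 0}

end Main

section LinearAlgebra

variable {R : Type u} [Ring R] {P₁ P₀ H X : Type v} [AddCommGroup P₁] [AddCommGroup P₀]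
  [AddCommGroup H] [AddCommGroup X] [Module R P₁] [Module R P₀] [Module R H] [Module R X]
  {d : P₁ →ₗ[R] P₀} {π : P₀ →ₗ[R] H}

/-- If every map of two-term complexes `P → P[1]` is null-homotopic, then every map from `P₁` to
a quotient of a finite power of `coker d` factors through `d`. -/
lemma exists_comp_eq_of_surjective [Module.Projective R P₁]
    (hπ : Function.Surjective π) (hex : Function.Exact d π)
    (hs : ∀ f : P₁ →ₗ[R] P₀, ∃ (s : P₁ →ₗ[R] P₁) (t : P₀ →ₗ[R] P₀),
      d ∘ₗ s + t ∘ₗ d = f)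
    {n : ℕ} (g : (Fin n → H) →ₗ[R] X) (hg : Function.Surjective g) (f : P₁ →ₗ[R] X) :
    ∃ h : P₀ →ₗ[R] X, h ∘ₗ d = f := by
  let q : (Fin n → P₀) →ₗ[R] X := g ∘ₗ LinearMap.pi fun i => π ∘ₗ LinearMap.proj i
  have hq : Function.Surjective q := by
    intro x
    obtain ⟨y, rfl⟩ := hg x
    choose z hz using fun i => hπ (y i)
    exact ⟨z, congrArg g (funext hz)⟩
  obtain ⟨f', rfl⟩ := Module.projective_lifting_property q f hq
  choose s t hst using fun i => hs (LinearMap.proj i ∘ₗ f')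
  refine ⟨q ∘ₗ LinearMap.pi t, LinearMap.ext fun p => ?_⟩
  have hf' : f' p = (fun i => d (s i p)) + fun i => t i (d p) := by
    funext i
    exact (LinearMap.congr_fun (hst i) p).symm
  have h0 : q (fun i => d (s i p)) = 0 := by
    have : (fun i => π (d (s i p))) = (0 : Fin n → H) :=
      funext fun i => hex.apply_apply_eq_zero _
    exact (congrArg g this).trans (map_zero g)
  change q (fun i => t i (d p)) = q (f' p)
  rw [hf', map_add, h0, zero_add]

/-- In a Noetherian module `X`, some map from a finite power of `H` to `X` has an image which
contains the image of every map from `H` to `X`. -/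
lemma exists_range_le [IsNoetherian R X] :
    ∃ (n : ℕ) (g : (Fin n → H) →ₗ[R] X), ∀ f : H →ₗ[R] X,
      LinearMap.range f ≤ LinearMap.range g := by
  let S : Set (Submodule R X) := {N | ∃ (n : ℕ) (g : (Fin n → H) →ₗ[R] X), LinearMap.range g = N}
  obtain ⟨N, ⟨n, g, rfl⟩, hN⟩ := set_has_maximal_iff_noetherian.mpr ‹IsNoetherian R X› S
    ⟨_, 0, 0, rfl⟩
  refine ⟨n, g, fun f => ?_⟩
  let g' : (Fin (n + 1) → H) →ₗ[R] X :=
    f ∘ₗ LinearMap.proj 0 + g ∘ₗ LinearMap.pi fun i => LinearMap.proj i.succ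
  have hg : LinearMap.range g ≤ LinearMap.range g' := by
    rintro _ ⟨y, rfl⟩
    exact ⟨Fin.cons 0 y, by simp [g']; rfl⟩
  have hf : LinearMap.range f ≤ LinearMap.range g' := by
    rintro _ ⟨y, rfl⟩
    refine ⟨Fin.cons y 0, ?_⟩
    have : (LinearMap.pi fun i : Fin n => LinearMap.proj (R := R) (φ := fun _ : Fin (n + 1) => H)
      i.succ) (Fin.cons y 0) = 0 := rfl
    simp [g', this]
  have : LinearMap.range g = LinearMap.range g' :=
    hg.eq_of_not_lt (hN _ ⟨_, g', rfl⟩)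
  exact this ▸ hf

/-- If the two-term complex `P` detects vanishing of modules, then every Noetherian module `X` such
that all maps `P₁ → X` factor through `d` is a quotient of a finite power of `coker d`. -/
lemma exists_surjective_of_factors [Module.Projective R P₁] [Module.Projective R P₀]
    [IsNoetherian R X] (hπ : Function.Surjective π) (hex : Function.Exact d π)
    (hs : ∀ f : P₁ →ₗ[R] P₀, ∃ (s : P₁ →ₗ[R] P₁) (t : P₀ →ₗ[R] P₀),
      d ∘ₗ s + t ∘ₗ d = f)
    (hgen : ∀ (Y : Type v) [AddCommGroup Y] [Module R Y],
      (∀ f : P₁ →ₗ[R] Y, ∃ h : P₀ →ₗ[R] Y, h ∘ₗ d = f) →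
      (∀ f : P₀ →ₗ[R] Y, f ∘ₗ d = 0 → f = 0) → Subsingleton Y)
    (hX : ∀ f : P₁ →ₗ[R] X, ∃ h : P₀ →ₗ[R] X, h ∘ₗ d = f) :
    ∃ (n : ℕ) (g : (Fin n → H) →ₗ[R] X), Function.Surjective g := by
  obtain ⟨n, g, hg⟩ := exists_range_le (R := R) (H := H) (X := X)
  refine ⟨n, g, ?_⟩
  rw [← LinearMap.range_eq_top, ← Submodule.Quotient.subsingleton_iff]
  have hmk := Submodule.mkQ_surjective (LinearMap.range g)
  refine hgen _ (fun f => ?_) (fun f hf => ?_)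
  · obtain ⟨f', rfl⟩ := Module.projective_lifting_property _ f hmk
    obtain ⟨h, rfl⟩ := hX f'
    exact ⟨Submodule.mkQ _ ∘ₗ h, rfl⟩
  · obtain ⟨f', rfl⟩ := Module.projective_lifting_property _ f hmk
    have hmem (p : P₁) : f' (d p) ∈ LinearMap.range g := by
      simpa using LinearMap.congr_fun hf p
    obtain ⟨h, hh⟩ := exists_comp_eq_of_surjective hπ hex hs g.rangeRestrict
      g.surjective_rangeRestrict ((f' ∘ₗ d).codRestrict _ hmem)
    let e : P₀ →ₗ[R] X := f' - (LinearMap.range g).subtype ∘ₗ h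
    have he : LinearMap.ker π ≤ LinearMap.ker e := by
      intro x hx
      obtain ⟨p, rfl⟩ := (hex x).mp hx
      have := congrArg Subtype.val (LinearMap.congr_fun hh p)
      simp only [LinearMap.comp_apply, LinearMap.codRestrict_apply] at this
      simp [e, this]
    ext x
    have hx : e x ∈ LinearMap.range g := by
      let e' : H →ₗ[R] X := (LinearMap.ker π).liftQ e he ∘ₗ
        (π.quotKerEquivOfSurjective hπ).symm.toLinearMap
      have : e' (π x) = e x := by
        have : (π.quotKerEquivOfSurjective hπ).symm (π x) = Submodule.Quotient.mk x := by
          rw [LinearEquiv.symm_apply_eq]; rfl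
        simp [e', this]
      exact hg e' ⟨π x, this⟩
    have : f' x = e x + (h x : X) := by simp [e]
    exact (Submodule.Quotient.mk_eq_zero _).mpr (this ▸ add_mem hx (h x).2)

end LinearAlgebra

section Orthogonal

variable {C : Type u} [Category.{v} C] [HasZeroObject C] [Preadditive C] [HasShift C ℤ]
  [∀ n : ℤ, (shiftFunctor C n).Additive] [Pretriangulated C]

/-- The objects which have no nonzero maps to any shift of `Y` form a thick class. -/
lemma isThick_setOf_forall_eq_zero (Y : C) :
    IsThick {Z : C | ∀ (i : ℤ) (f : Z ⟶ Y⟦i⟧), f = 0} := by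
  refine ⟨fun Z W e hZ i f => ?_, fun Z n hZ i f => ?_, fun T hT h₁ h₃ i f => ?_,
    fun Z W ι r h hW i f => ?_⟩
  · rw [← cancel_epi e.hom, hZ i (e.hom ≫ f), comp_zero]
  · apply (shiftFunctor C (-n)).map_injective
    rw [Functor.map_zero, ← cancel_epi ((shiftShiftNeg Z n).inv),
      ← cancel_mono ((shiftFunctorAdd' C i (-n) _ rfl).inv.app Y), comp_zero, zero_comp]
    exact hZ _ _
  · obtain ⟨g, rfl⟩ := Triangle.yoneda_exact₂ T hT f (h₁ i _)
    rw [h₃ i g, comp_zero]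
  · rw [← Category.id_comp f, ← h, Category.assoc, hW i (r ≫ f), comp_zero]

end Orthogonal

section HomComplex

open CochainComplex HomComplex

variable {C : Type u} [Category.{v} C] [Abelian C] [HasDerivedCategory.{w} C]

/-- For a K-projective complex `K`, maps `K ⟶ L⟦n⟧` in the derived category are all zero iff
all `n`-cocycles are coboundaries. -/
lemma forall_hom_shift_eq_zero_iff (K L : CochainComplex C ℤ) [K.IsKProjective] (n : ℤ) :
    (∀ f : DerivedCategory.Q.obj K ⟶ (DerivedCategory.Q.obj L)⟦n⟧, f = 0) ↔
      ∀ z : Cocycle K L n, z ∈ coboundaries K L n := by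
  let e : CohomologyClass K L n ≃
      (DerivedCategory.Q.obj K ⟶ (DerivedCategory.Q.obj L)⟦n⟧) :=
    (Equiv.ofBijective _ (CohomologyClass.toHom_bijective K L n)).trans <|
    (Equiv.ofBijective _ (IsKProjective.Qh_map_bijective K _)).trans <|
    Iso.homCongr ((DerivedCategory.quotientCompQhIso C).app K)
      ((DerivedCategory.quotientCompQhIso C).app (L⟦n⟧) ≪≫
        (DerivedCategory.Q.commShiftIso n).app L)
  have h₁ : (∀ z : Cocycle K L n, z ∈ coboundaries K L n) ↔
      Subsingleton (CohomologyClass K L n) := by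
    simp only [← CohomologyClass.mk_eq_zero_iff]
    exact ⟨fun h => subsingleton_of_forall_eq 0 fun x => by
      obtain ⟨z, rfl⟩ := x.mk_surjective; exact h z, fun _ _ => Subsingleton.elim _ _⟩
  rw [h₁, e.subsingleton_congr]
  exact ⟨fun h => subsingleton_of_forall_eq 0 h, fun _ _ => Subsingleton.elim _ _⟩

/-- Maps from a K-projective complex to a shifted object all vanish in the derived category iff
the corresponding complex of morphisms in `C` is exact. -/
lemma forall_hom_single_shift_eq_zero_iff (K : CochainComplex C ℤ) [K.IsKProjective] (X : C)
    (n p p' p'' : ℤ) (h : p + n = 0) (hp' : p' + 1 = p) (hp'' : p + 1 = p'') :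
    (∀ f : DerivedCategory.Q.obj K ⟶ ((DerivedCategory.singleFunctor C 0).obj X)⟦n⟧, f = 0) ↔
      ∀ f : K.X p ⟶ X, K.d p' p ≫ f = 0 → ∃ g : K.X p'' ⟶ X, K.d p p'' ≫ g = f := by
  refine (forall_hom_shift_eq_zero_iff K ((CochainComplex.singleFunctor C 0).obj X) n).trans
    ⟨fun hz f hf => ?_, fun hf z => ?_⟩
  · exact (Cocycle.toSingleMk_mem_coboundaries_iff f h p' hp' hf p'' hp'').mp (hz _)
  · obtain ⟨f, hf', rfl⟩ := Cocycle.toSingleMk_surjective z p h p' hp'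
    exact (Cocycle.toSingleMk_mem_coboundaries_iff f h p' hp' hf' p'' hp'').mpr (hf f hf')

end HomComplex

section TwoTerm

open CochainComplex HomComplex

variable {R : Type} [Ring R] {P : CochainComplex (ModuleCat.{0} R) ℤ}

lemma IsTwoTermCplx.isKProjective (hP : IsTwoTermCplx R P) : P.IsKProjective := by
  have : P.IsStrictlyLE 0 := (isStrictlyLE_iff _ _).mpr fun i hi =>
    hP.2.2 i (by lia) (by lia)
  have := hP.1
  exact isKProjective_of_projective P 0

/-- The degree zero cohomology of a two-term complex is the cokernel of its differential. -/
lemma IsTwoTermCplx.exists_exact (hP : IsTwoTermCplx R P) :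
    ∃ π : P.X 0 →ₗ[R] P.homology 0,
      Function.Surjective π ∧ Function.Exact (P.d (-1) 0).hom π := by
  have h01 : P.d 0 1 = 0 := (hP.2.2 1 (by simp) (by simp)).eq_of_tgt _ _
  have := P.isIso_homologyι 0 1 (by simp) h01
  let π : P.X 0 ⟶ P.homology 0 := P.pOpcycles 0 ≫ inv (P.homologyι 0)
  have w : P.d (-1) 0 ≫ π = 0 := by simp [π]
  let S : ShortComplex (ModuleCat R) := ShortComplex.mk _ _ w
  have hS : S.Exact := by
    let S' : ShortComplex (ModuleCat R) :=
      ShortComplex.mk (P.d (-1) 0) (P.pOpcycles 0) (by simp)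
    have : S'.Exact := S'.exact_of_g_is_cokernel (P.opcyclesIsCokernel (-1) 0 (by simp))
    refine (ShortComplex.exact_iff_of_iso (ShortComplex.isoMk (Iso.refl _) (Iso.refl _)
      (asIso (P.homologyι 0)) ?_ ?_ : S ≅ S')).mpr this
    · simp [S, S']
    · simp [S, S', π]
  have : Epi π := inferInstance
  exact ⟨π.hom, (ModuleCat.epi_iff_surjective _).mp this,
    (ShortComplex.ShortExact.moduleCat_exact_iff_function_exact S).mp hS⟩

variable [HasDerivedCategory.{w} (ModuleCat.{0} R)]

lemma IsTwoTermSilting.exists_homotopy (hP : IsTwoTermSilting R P) (f : P.X (-1) ⟶ P.X 0) :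
    ∃ (s : P.X (-1) ⟶ P.X (-1)) (t : P.X 0 ⟶ P.X 0),
      s ≫ P.d (-1) 0 + P.d (-1) 0 ≫ t = f := by
  have := hP.1.isKProjective
  let z : Cocycle P P 1 := Cocycle.mk (Cochain.single f 1) 2 (by simp) (by
    refine Cochain.ext _ _ fun p q hpq => ?_
    by_cases hp : p = -1
    · exact (hP.1.2.2 q (by lia) (by lia)).eq_of_tgt _ _
    · by_cases hp₀ : p = 0
      · exact (hP.1.2.2 q (by lia) (by lia)).eq_of_tgt _ _
      · exact (hP.1.2.2 p hp hp₀).eq_of_src _ _)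
  obtain ⟨β, hβ⟩ := (mem_coboundaries_iff z 0 (by simp)).mp
    ((forall_hom_shift_eq_zero_iff P P 1).mp hP.2.1 z)
  have h := Cochain.congr_v hβ (-1) 0 (by simp)
  rw [δ_v 0 1 (by simp) β (-1) 0 (by simp) (-1) 0 (by simp) (by simp)] at h
  refine ⟨β.v (-1) (-1) (by simp), -β.v 0 0 (by simp), ?_⟩
  simpa [z] using h

/-- A module `Y` with `Hom_D(P, Y[i]) = 0` for `i = 0, 1` vanishes. -/
lemma IsTwoTermSilting.subsingleton (hP : IsTwoTermSilting R P) (Y : ModuleCat.{0} R)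
    (h₁ : ∀ f : P.X (-1) ⟶ Y, ∃ g : P.X 0 ⟶ Y, P.d (-1) 0 ≫ g = f)
    (h₀ : ∀ f : P.X 0 ⟶ Y, P.d (-1) 0 ≫ f = 0 → f = 0) : Subsingleton Y := by
  have := hP.1.isKProjective
  have hPY := hP.2.2 _
    (isThick_setOf_forall_eq_zero ((DerivedCategory.singleFunctor (ModuleCat R) 0).obj Y))
    fun i => (forall_hom_single_shift_eq_zero_iff P Y i (-i) (-i - 1) (-i + 1)
      (by simp) (by simp) rfl).mpr (by
        intro f hf
        obtain rfl | hi₀ := eq_or_ne i 0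
        · exact ⟨0, by simpa using (h₀ f hf).symm⟩
        obtain rfl | hi₁ := eq_or_ne i 1
        · exact h₁ f
        · exact ⟨0, (hP.1.2.2 (-i) (by lia) (by lia)).eq_of_src _ _⟩)
  have hR := hPY ((HomologicalComplex.single (ModuleCat R) (.up ℤ) 0).obj (ModuleCat.of R R)) ?_ 0
  · refine subsingleton_of_forall_eq 0 fun y => ?_
    let φ : ModuleCat.of R R ⟶ Y := ModuleCat.ofHom (LinearMap.toSpanSingleton R Y y)
    have hφ : φ = 0 := by
      apply (DerivedCategory.singleFunctor (ModuleCat R) 0).map_injective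
      rw [Functor.map_zero, ← cancel_mono ((shiftFunctorZero _ ℤ).inv.app _), zero_comp]
      exact hR _
    simpa [φ] using congrArg (fun ψ : ModuleCat.of R R ⟶ Y => ψ.hom 1) hφ
  · have hz (i : ℤ) (hi : i ≠ 0) := HomologicalComplex.isZero_single_obj_X (.up ℤ) 0
      (ModuleCat.of R R) i hi
    have e := HomologicalComplex.singleObjXSelf (.up ℤ) 0 (ModuleCat.of R R)
    refine ⟨fun i => ?_, fun i => ?_, 0, 0, fun i hi => hz i (by lia)⟩
    · obtain rfl | hi := eq_or_ne i 0
      · exact Projective.of_iso e.symm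
          ((IsProjective.iff_projective (ModuleCat.of R R)).mp inferInstance)
      · exact (hz i hi).projective
    · obtain rfl | hi := eq_or_ne i 0
      · exact Module.Finite.equiv e.symm.toLinearEquiv
      · have := ModuleCat.subsingleton_of_isZero (hz i hi)
        infer_instance

end TwoTerm

/-- For a 2-term silting complex `P` in `K^b(proj A)`, we have
`T(P) = Fac H^0(P)`: a finitely generated module `X` satisfies `Hom_D(P, X[1]) = 0`
iff `X` is a quotient of a finite direct sum of copies of `H^0(P)`. -/
theorem TT_eq_fac_H0
    (k A : Type) [Field k] [Ring A] [Algebra k A] [FiniteDimensional k A]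
    [HasDerivedCategory.{w} (ModuleCat.{0} Aᵐᵒᵖ)]
    (P : CochainComplex (ModuleCat.{0} Aᵐᵒᵖ) ℤ)
    (hP : IsTwoTermSilting Aᵐᵒᵖ P)
    (X : ModuleCat.{0} Aᵐᵒᵖ) (hX : Module.Finite Aᵐᵒᵖ X) :
    X ∈ TT P ↔
      ∃ (n : ℕ) (g : (Fin n → ↥(P.homology 0)) →ₗ[Aᵐᵒᵖ] X), Function.Surjective g := by
  have : Module.Finite k Aᵐᵒᵖ := Module.Finite.equiv (MulOpposite.opLinearEquiv k)
  have : IsNoetherianRing Aᵐᵒᵖ := isNoetherian_of_tower k inferInstance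
  have := hP.1.isKProjective
  have hproj (i : ℤ) : Module.Projective Aᵐᵒᵖ (P.X i) :=
    (IsProjective.iff_projective _).mpr (hP.1.1 i)
  obtain ⟨π, hπ, hex⟩ := hP.1.exists_exact
  have hs (f : P.X (-1) →ₗ[Aᵐᵒᵖ] P.X 0) :
      ∃ (s : P.X (-1) →ₗ[Aᵐᵒᵖ] P.X (-1)) (t : P.X 0 →ₗ[Aᵐᵒᵖ] P.X 0),
        (P.d (-1) 0).hom ∘ₗ s + t ∘ₗ (P.d (-1) 0).hom = f := by
    obtain ⟨s, t, h⟩ := hP.exists_homotopy (ModuleCat.ofHom f)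
    exact ⟨s.hom, t.hom, congrArg ModuleCat.Hom.hom h⟩
  have hTT : X ∈ TT P ↔ ∀ f : P.X (-1) →ₗ[Aᵐᵒᵖ] X,
      ∃ h : P.X 0 →ₗ[Aᵐᵒᵖ] X, h ∘ₗ (P.d (-1) 0).hom = f := by
    refine (and_iff_right hX).trans ((forall_hom_single_shift_eq_zero_iff P X 1 (-1) (-2) 0
      (by simp) (by simp) (by simp)).trans ⟨fun h f => ?_, fun h f _ => ?_⟩)
    · obtain ⟨g, hg⟩ := h (ModuleCat.ofHom f)
        ((hP.1.2.2 (-2) (by simp) (by simp)).eq_of_src _ _)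
      exact ⟨g.hom, congrArg ModuleCat.Hom.hom hg⟩
    · obtain ⟨g, hg⟩ := h f.hom
      exact ⟨ModuleCat.ofHom g, ModuleCat.hom_ext hg⟩
  rw [hTT]
  refine ⟨exists_surjective_of_factors hπ hex hs fun Y _ _ h₁ h₀ => ?_,
    fun ⟨n, g, hg⟩ => exists_comp_eq_of_surjective hπ hex hs g hg⟩
  refine hP.subsingleton (ModuleCat.of Aᵐᵒᵖ Y) (fun f => ?_) (fun f hf => ?_)
  · obtain ⟨g, hg⟩ := h₁ f.hom
    exact ⟨ModuleCat.ofHom g, ModuleCat.hom_ext hg⟩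
  · exact ModuleCat.hom_ext (h₀ f.hom (congrArg ModuleCat.Hom.hom hf))

end

end TwoTermSilting
end

section
/- Let P be a 2-term silting complex in K^b(proj A), B = End_D(P), and let m ≥ 0. If X is an object of C(P) lying in 𝒫_C * 𝒫_C[1] * ... * 𝒫_C[m], then the B-module Hom_D(P, X) has projective dimension at most m. -/
/-!
Common setup: we model right `A`-modules as `ModuleCat Aᵐᵒᵖ`, the bounded derived
category `D^b(mod A)` as the full subcategory (given by the predicate `InDb`) of the
derived category of `Mod Aᵐᵒᵖ` consisting of cohomologically bounded complexes with
finitely generated cohomology, and `K^b(proj A)` via bounded complexes of finitely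
generated projective modules (`IsPerfCplx`).
-/

namespace TwoTermSilting

open CategoryTheory Limits Pretriangulated

universe w v u

noncomputable section

section Vanishing

variable {C : Type u} [Category.{v} C] [Preadditive C] [HasShift C ℤ]

/-- All morphisms from `P` to the `i`-th shift of `X` vanish. -/
def HomShiftVanishes (P X : C) (i : ℤ) : Prop := ∀ f : P ⟶ X⟦i⟧, f = 0

lemma HomShiftVanishes.of_iso {P X Y : C} {i : ℤ} (h : HomShiftVanishes P X i) (e : X ≅ Y) :
    HomShiftVanishes P Y i := by
  intro f
  rw [← cancel_mono ((shiftFunctor C i).mapIso e).inv, zero_comp]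
  exact h _

lemma HomShiftVanishes.shift {P X : C} {a i j : ℤ} (h : HomShiftVanishes P X j)
    (hj : a + i = j) : HomShiftVanishes P (X⟦a⟧) i := by
  intro f
  rw [← cancel_mono ((shiftFunctorAdd' C a i j hj).app X).inv, zero_comp]
  exact h _

lemma homShiftVanishes_of_mem_shiftSet {P : C} {S : Set C} {i j k : ℤ} (hij : i + j = k)
    (hS : ∀ Q ∈ S, HomShiftVanishes P Q k) {X : C} (hX : X ∈ shiftSet S i) :
    HomShiftVanishes P X j := by
  obtain ⟨Q, hQ, ⟨e⟩⟩ := hX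
  exact ((hS Q hQ).shift hij).of_iso e.symm

end Vanishing

section Chain

variable {C : Type u} [Category.{v} C] [HasZeroObject C] [Preadditive C] [HasShift C ℤ]
  [∀ n : ℤ, (shiftFunctor C n).Additive] [Pretriangulated C]

lemma star_mono {S S' T T' : Set C} (hS : S ⊆ S') (hT : T ⊆ T') : star S T ⊆ star S' T' := by
  rintro Z ⟨X, Y, f, g, h, hX, hY, hd⟩
  exact ⟨X, Y, f, g, h, hS hX, hT hY, hd⟩

lemma star_assoc_subset [IsTriangulated C] (S T U : Set C) :
    star (star S T) U ⊆ star S (star T U) := by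
  rintro Z ⟨V, Y, f, g, h, ⟨X, W, f', g', h', hX, hW, hd'⟩, hY, hd⟩
  obtain ⟨N, g₁, h₁, hd₁⟩ := distinguished_cocone_triangle (f' ≫ f)
  let o := Triangulated.someOctahedron rfl hd' hd hd₁
  exact ⟨X, N, f' ≫ f, g₁, h₁, hX, ⟨W, Y, _, _, _, hW, hY, o.mem⟩, hd₁⟩

lemma starChain_succ_subset [IsTriangulated C] (f : ℕ → Set C) (n : ℕ) :
    starChain f (n + 1) ⊆ star (f 0) (starChain (fun i => f (i + 1)) n) := by
  induction n with
  | zero => exact subset_rfl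
  | succ n ih =>
    exact (star_mono ih subset_rfl).trans (star_assoc_subset _ _ _)

lemma shift_mem_starChain {f g : ℕ → Set C} (a : ℤ) (hfg : ∀ i, ∀ X ∈ f i, X⟦a⟧ ∈ g i) (n : ℕ)
    {X : C} (hX : X ∈ starChain f n) : X⟦a⟧ ∈ starChain g n := by
  induction n generalizing X with
  | zero => exact hfg 0 X hX
  | succ n ih =>
    obtain ⟨Y, Z, u, v, w, hY, hZ, hd⟩ := hX
    exact ⟨Y⟦a⟧, Z⟦a⟧, _, _, _, ih hY, hfg _ _ hZ, Triangle.shift_distinguished _ hd a⟩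

lemma HomShiftVanishes.obj₂ {P : C} {T : Triangle C} (hT : T ∈ distTriang C) {i : ℤ}
    (h₁ : HomShiftVanishes P T.obj₁ i) (h₃ : HomShiftVanishes P T.obj₃ i) :
    HomShiftVanishes P T.obj₂ i := by
  intro f
  obtain ⟨g, rfl⟩ := Triangle.coyoneda_exact₂ _ (Triangle.shift_distinguished T hT i) f (h₃ _)
  rw [h₁ g]
  exact zero_comp

lemma homShiftVanishes_of_mem_starChain {P : C} {f : ℕ → Set C} {i : ℤ}
    (hf : ∀ j, ∀ X ∈ f j, HomShiftVanishes P X i) (n : ℕ) {X : C} (hX : X ∈ starChain f n) :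
    HomShiftVanishes P X i := by
  induction n generalizing X with
  | zero => exact hf 0 X hX
  | succ n ih =>
    obtain ⟨Y, Z, u, v, w, hY, hZ, hd⟩ := hX
    exact HomShiftVanishes.obj₂ hd (ih hY) (hf _ _ hZ)

end Chain

section HomModule

variable {C : Type u} [Category.{v} C] [Preadditive C]

/-- Postcomposition with `g`, as a morphism of right `End P`-modules. -/
def postcompHom (P : C) {X Y : C} (g : X ⟶ Y) :
    ModuleCat.of (End P)ᵐᵒᵖ (P ⟶ X) ⟶ ModuleCat.of (End P)ᵐᵒᵖ (P ⟶ Y) :=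
  ModuleCat.ofHom
    { toFun := fun f => f ≫ g
      map_add' := fun _ _ => Preadditive.add_comp _ _ _ _ _ _
      map_smul' := fun _ _ => Category.assoc _ _ _ }

end HomModule

lemma pdLE_of_iso {R : Type u} [Ring R] {n : ℕ} {M N : ModuleCat.{v} R} (e : M ≅ N)
    (h : pdLE R n M) : pdLE R n N := by
  induction n generalizing M N with
  | zero => exact Projective.of_iso e h
  | succ n ih =>
    obtain ⟨P, f, hP, hf, hk⟩ := h
    exact ⟨P, f ≫ e.hom, hP, epi_comp _ _, ih (kernelCompMono f e.hom).symm hk⟩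

section Syzygy

variable {C : Type u} [Category.{v} C] [HasZeroObject C] [Preadditive C] [HasShift C ℤ]
  [∀ n : ℤ, (shiftFunctor C n).Additive] [Pretriangulated C]

lemma projective_hom_of_mem_addOf {P X : C} (hX : X ∈ addOf P) :
    Projective (ModuleCat.of (End P)ᵐᵒᵖ (P ⟶ X)) := by
  obtain ⟨n, ι, r, hr⟩ := hX
  rw [← IsProjective.iff_projective]
  let s : (P ⟶ X) →ₗ[(End P)ᵐᵒᵖ] (Fin n → (End P)ᵐᵒᵖ) :=
    { toFun := fun f j => MulOpposite.op (f ≫ ι ≫ biproduct.π _ j)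
      map_add' := fun f g => by
        funext j
        exact congrArg MulOpposite.op (Preadditive.add_comp _ _ _ f g _)
      map_smul' := fun b f => by
        funext j
        exact congrArg MulOpposite.op (Category.assoc b.unop f _) }
  let p : (Fin n → (End P)ᵐᵒᵖ) →ₗ[(End P)ᵐᵒᵖ] (P ⟶ X) :=
    Fintype.linearCombination (End P)ᵐᵒᵖ (fun j => biproduct.ι (fun _ : Fin n => P) j ≫ r)
  refine Module.Projective.of_split s p ?_
  ext f
  have h : p (s f) = ∑ j, (f ≫ ι ≫ biproduct.π _ j) ≫ biproduct.ι (fun _ : Fin n => P) j ≫ r :=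
    Fintype.linearCombination_apply _ _ _
  change p (s f) = f
  rw [h]
  calc _ = f ≫ ι ≫ (∑ j, biproduct.π (fun _ : Fin n => P) j ≫
          biproduct.ι (fun _ : Fin n => P) j) ≫ r := by
        simp only [Preadditive.comp_sum, Preadditive.sum_comp, Category.assoc]
    _ = f := by rw [biproduct.total, Category.id_comp, hr, Category.comp_id]

lemma mem_addOf_of_iso {P X Y : C} (e : X ≅ Y) (hX : X ∈ addOf P) :
    Y ∈ addOf P := by
  obtain ⟨n, ι, r, hr⟩ := hX
  exact ⟨n, e.inv ≫ ι, r ≫ e.hom, by simp [reassoc_of% hr]⟩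

lemma pdLE_succ_of_distTriang {P : C} {T : Triangle C} (hT : T ∈ distTriang C) {n : ℕ}
    (h₁ : HomShiftVanishes P T.obj₁ 1) (h₃ : HomShiftVanishes P T.obj₃ (-1))
    (hP : Projective (ModuleCat.of (End P)ᵐᵒᵖ (P ⟶ T.obj₂)))
    (hn : pdLE.{v} (End P)ᵐᵒᵖ n (ModuleCat.of (End P)ᵐᵒᵖ (P ⟶ T.obj₁))) :
    pdLE.{v} (End P)ᵐᵒᵖ (n + 1) (ModuleCat.of (End P)ᵐᵒᵖ (P ⟶ T.obj₃)) := by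
  have hinj : Function.Injective (postcompHom P T.mor₁).hom := by
    rw [injective_iff_map_eq_zero]
    intro (f : P ⟶ T.obj₁) (hf : f ≫ T.mor₁ = 0)
    obtain ⟨g, rfl⟩ := Triangle.coyoneda_exact₂ _ (inv_rot_of_distTriang _ hT) f hf
    rw [h₃ g]
    exact zero_comp
  have hsurj : Function.Surjective (postcompHom P T.mor₂).hom := by
    intro (f : P ⟶ T.obj₃)
    obtain ⟨g, rfl⟩ := Triangle.coyoneda_exact₃ _ hT f (h₁ _)
    exact ⟨g, rfl⟩
  let S : ShortComplex (ModuleCat (End P)ᵐᵒᵖ) :=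
    ShortComplex.mk (postcompHom P T.mor₁) (postcompHom P T.mor₂) (by
      ext (f : P ⟶ T.obj₁)
      change (f ≫ T.mor₁) ≫ T.mor₂ = 0
      rw [Category.assoc, comp_distTriang_mor_zero₁₂ _ hT, comp_zero])
  have hex : S.Exact := by
    rw [ShortComplex.moduleCat_exact_iff]
    intro (f : P ⟶ T.obj₂) (hf : f ≫ T.mor₂ = 0)
    obtain ⟨g, rfl⟩ := Triangle.coyoneda_exact₂ _ hT f hf
    exact ⟨g, rfl⟩
  have : Mono S.f := (ModuleCat.mono_iff_injective _).2 hinj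
  exact ⟨_, postcompHom P T.mor₂, hP, (ModuleCat.epi_iff_surjective _).2 hsurj,
    pdLE_of_iso (hex.fIsKernel.conePointUniqueUpToIso (limit.isLimit _)) hn⟩

lemma pdLE_hom_of_mem_starChain [IsTriangulated C] {P : C} {S : Set C}
    (hadd : S ⊆ addOf P) (hvan : ∀ Q ∈ S, ∀ i : ℤ, i ≠ 0 → HomShiftVanishes P Q i)
    (m : ℕ) {X : C} (hX : ∀ i : ℤ, i ≠ 0 → HomShiftVanishes P X i)
    (hX' : X ∈ starChain (fun i => shiftSet S (i : ℤ)) m) :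
    pdLE.{v} (End P)ᵐᵒᵖ m (ModuleCat.of (End P)ᵐᵒᵖ (P ⟶ X)) := by
  have hproj : ∀ Y ∈ shiftSet S ((0 : ℕ) : ℤ),
      Projective (ModuleCat.of (End P)ᵐᵒᵖ (P ⟶ Y)) := by
    rintro Y ⟨Q, hQ, ⟨e⟩⟩
    exact projective_hom_of_mem_addOf
      (mem_addOf_of_iso ((shiftFunctorZero C ℤ).symm.app Q ≪≫ e.symm) (hadd hQ))
  induction m generalizing X with
  | zero => exact hproj X hX'
  | succ m ih =>
    obtain ⟨Q, W, f, g, h, hQ, hW, hd⟩ := starChain_succ_subset _ m hX'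
    have hW' : W⟦(-1 : ℤ)⟧ ∈ starChain (fun i => shiftSet S (i : ℤ)) m := by
      refine shift_mem_starChain (-1) ?_ m hW
      rintro i Y ⟨R, hR, ⟨e⟩⟩
      exact ⟨R, hR, ⟨(shiftFunctor C (-1 : ℤ)).mapIso e ≪≫
        ((shiftFunctorAdd' C ((i + 1 : ℕ) : ℤ) (-1) (i : ℤ) (by push_cast; ring)).app R).symm⟩⟩
    have hone : HomShiftVanishes P (W⟦(-1 : ℤ)⟧) 1 :=
      homShiftVanishes_of_mem_starChain (fun j Y hY =>
        homShiftVanishes_of_mem_shiftSet rfl (fun R hR => hvan R hR _ (by lia)) hY) m hW'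
    have hT := inv_rot_of_distTriang _ hd
    refine pdLE_succ_of_distTriang hT hone (hX _ (by lia)) (hproj Q hQ) (ih ?_ hW')
    intro i hi
    by_cases hi₁ : i = 1
    · exact hi₁ ▸ hone
    · exact HomShiftVanishes.obj₂ (inv_rot_of_distTriang _ hT)
        ((hX (-1 + i) (by lia)).shift rfl)
        (homShiftVanishes_of_mem_shiftSet (by simp) (fun R hR => hvan R hR i hi) hQ)

end Syzygy

/-- Let `P` be a 2-term silting complex, `B = End_D(P)`, `m ≥ 0`.
If `X ∈ C(P)` lies in `𝒫_C * 𝒫_C[1] * ⋯ * 𝒫_C[m]` where `𝒫_C = add P ∩ C(P)`, then the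
right `B`-module `Hom_D(P, X)` has projective dimension at most `m`. -/
theorem pd_hom_le_of_mem_starChain_addCP
    (k A : Type) [Field k] [Ring A] [Algebra k A] [FiniteDimensional k A]
    [HasDerivedCategory.{w} (ModuleCat.{0} Aᵐᵒᵖ)]
    (P : CochainComplex (ModuleCat.{0} Aᵐᵒᵖ) ℤ)
    (hP : IsTwoTermSilting Aᵐᵒᵖ P)
    (m : ℕ) (X : DerivedCategory (ModuleCat.{0} Aᵐᵒᵖ))
    (hX : X ∈ CP P)
    (hX' : X ∈ starChain
      (fun i => shiftSet (addOf (DerivedCategory.Q.obj P) ∩ CP P) (i : ℤ)) m) :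
    pdLE.{w, w} (End (DerivedCategory.Q.obj P))ᵐᵒᵖ m
      (ModuleCat.of (End (DerivedCategory.Q.obj P))ᵐᵒᵖ
        (DerivedCategory.Q.obj P ⟶ X)) := by
  exact pdLE_hom_of_mem_starChain (fun _ hQ => hQ.1) (fun _ hQ => hQ.2.2) m hX.2 hX'

end

end TwoTermSilting
end
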